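/- arXiv:2204.10442 — 9 statements merged into one kernel-verified Lean document; each statement's English description precedes it below -/
import Mathlib

section
/- Let i, j ∈ I, r, s ≥ 1, and let p ∈ ℤ satisfy −d([i,j],∂I) ≤ p < min(r,s); set m = r+s+|i−j|−2p. Then the interval J₀ = [min(i,j)+min(p,0), max(i,j)−min(p,0)] satisfies [i,j] ⊆ J₀ ⊆ I and m ∈ ℛ^{r,s}_{i,j,J₀}, and J₀ is contained in every interval K with [i,j] ⊆ K ⊆ I and m ∈ ℛ^{r,s}_{i,j,K}; thus J₀ is the unique minimal such interval. In particular, if p ≤ 0 then both endpoints of J₀ are at distance −p from the corresponding endpoints of [i,j] and ȟ_{J₀} = |i−j|−2p+2, while if p ≥ 0 then J₀ = [i,j] and ȟ_{J₀} = |i−j|+2. -/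
/-- `RSet i j a b r s` is `ℛ^{r,s}_{i,j,[a,b]}`
`= { r+s+|i−j|−2q : −d([i,j],∂[a,b]) ≤ q < min(r,s) }` where
`d([i,j],∂[a,b]) = min(min(i,j)−a, b−max(i,j))`. -/
def RSet (i j a b r s : ℤ) : Set ℤ :=
  {m | ∃ q : ℤ, -(min (min i j - a) (b - max i j)) ≤ q ∧ q < min r s ∧
    m = r + s + |i - j| - 2 * q}

/-- minimality and description of the interval `J₀`. -/
theorem stmt2 (n i j r s p m a₀ b₀ : ℤ) (hn : 1 ≤ n)
    (hi : 1 ≤ i ∧ i ≤ n) (hj : 1 ≤ j ∧ j ≤ n) (hr : 1 ≤ r) (hs : 1 ≤ s)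
    (hp : -(min (min i j - 1) (n - max i j)) ≤ p ∧ p < min r s)
    (hm : m = r + s + |i - j| - 2 * p)
    (ha₀ : a₀ = min i j + min p 0) (hb₀ : b₀ = max i j - min p 0) :
    (1 ≤ a₀ ∧ a₀ ≤ min i j ∧ max i j ≤ b₀ ∧ b₀ ≤ n) ∧
    m ∈ RSet i j a₀ b₀ r s ∧
    (∀ a b : ℤ, 1 ≤ a → a ≤ min i j → max i j ≤ b → b ≤ n →
      m ∈ RSet i j a b r s → a ≤ a₀ ∧ b₀ ≤ b) ∧
    (p ≤ 0 → min i j - a₀ = -p ∧ b₀ - max i j = -p ∧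
      b₀ - a₀ + 2 = |i - j| - 2 * p + 2) ∧
    (0 ≤ p → a₀ = min i j ∧ b₀ = max i j ∧ b₀ - a₀ + 2 = |i - j| + 2) := by
  have habs : |i - j| = max i j - min i j := (max_sub_min_eq_abs' i j).symm
  refine ⟨by omega, ⟨p, by omega, hp.2, hm⟩, ?_, by omega, by omega⟩
  rintro a b h1 h2 h3 h4 ⟨q, hq1, hq2, hq3⟩
  have hqp : q = p := by omega
  omega
end

section
/- Adopt the standing hypotheses and assume p ≤ 0, j' ∈ J, and m' ∈ ℛ^{s,s'}_{j,j',J}. Then d([j,j'],∂J) = d([i,j'],∂J) = −p − d^{j'}_{i,j} and p' ≥ p + d^{j'}_{i,j}. Consequently m − m' ≥ r − s' + |i−j'|; in particular, if m ≤ m' then r ≤ s' − |i−j'| ≤ s'. -/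
/-- `dE k i j` is `d^k_{i,j} = (|k−i| + |k−j| − |i−j|)/2`. -/
def dE (k i j : ℤ) : ℤ := (|k - i| + |k - j| - |i - j|) / 2

/-- standing hypotheses, case p ≤ 0. -/
theorem stmt4 (n i j j' r s s' p p' m m' pp pm aJ bJ : ℤ)
    (hn : 1 ≤ n)
    (hi : 1 ≤ i ∧ i ≤ n) (hj : 1 ≤ j ∧ j ≤ n) (hj2 : 1 ≤ j' ∧ j' ≤ n)
    (hr : 1 ≤ r) (hs : 1 ≤ s) (hs2 : 1 ≤ s')
    (hp : -(min (min i j - 1) (n - max i j)) ≤ p ∧ p < min r s)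
    (hp2 : -(min (min j j' - 1) (n - max j j')) ≤ p' ∧ p' < min s s')
    (hm : m = r + s + |i - j| - 2 * p)
    (hm2 : m' = s + s' + |j - j'| - 2 * p')
    (hnt : |m - m'| ∉ RSet i j' 1 n r s')
    (hpp : pp = s' - p' + p + dE j' i j)
    (hpm : pm = r - p + p' + dE i j j')
    (haJ : aJ = min i j + min p 0) (hbJ : bJ = max i j - min p 0)
    (hple : p ≤ 0) (hj'J : aJ ≤ j' ∧ j' ≤ bJ)
    (hm'J : m' ∈ RSet j j' aJ bJ s s') :
    min (min j j' - aJ) (bJ - max j j') = -p - dE j' i j ∧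
    min (min i j' - aJ) (bJ - max i j') = -p - dE j' i j ∧
    p + dE j' i j ≤ p' ∧
    r - s' + |i - j'| ≤ m - m' ∧
    (m ≤ m' → r ≤ s' - |i - j'| ∧ s' - |i - j'| ≤ s') := by
  obtain ⟨q, hq1, hq2, hq3⟩ := hm'J
  have hqp : q = p' := by omega
  subst hqp
  clear hnt hpp hpm hp hp2 hi hj hj2
  rw [min_eq_left hple] at haJ hbJ
  obtain ⟨h1, h2⟩ := hj'J
  have hd : |j' - i| + |j' - j| - |i - j| = 2 * dE j' i j := by
    unfold dE
    rcases abs_cases (j' - i) with h | h <;> rcases abs_cases (j' - j) with h' | h' <;>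
      rcases abs_cases (i - j) with h'' | h'' <;> omega
  generalize dE j' i j = D at *
  rw [abs_sub_comm j' i, abs_sub_comm j' j] at hd
  have hA : min (min j j' - aJ) (bJ - max j j') = -p - D := by
    clear hq1 hq2 hq3 hm hm2 hr hs hs2 hn
    subst haJ hbJ
    rcases le_total i j with a | a <;> rcases le_total j j' with b | b <;>
      rcases le_total i j' with c | c <;>
      simp only [a, b, c, min_eq_left, min_eq_right, max_eq_left, max_eq_right, abs_of_nonneg, abs_of_nonpos, sub_nonneg, sub_nonpos] at hd h1 h2 ⊢ <;> omega
  have hB : min (min i j' - aJ) (bJ - max i j') = -p - D := by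
    clear hq1 hq2 hq3 hm hm2 hr hs hs2 hn
    subst haJ hbJ
    clear hA
    rcases le_total i j with a | a <;> rcases le_total j j' with b | b <;>
      rcases le_total i j' with c | c <;>
      simp only [a, b, c, min_eq_left, min_eq_right, max_eq_left, max_eq_right, abs_of_nonneg, abs_of_nonpos, sub_nonneg, sub_nonpos] at hd h1 h2 ⊢ <;> omega
  rw [hA] at hq1
  have h0 := abs_nonneg (i - j')
  refine ⟨hA, hB, ?_, ?_, fun h => ⟨?_, ?_⟩⟩ <;> linarith
end

section
/- Adopt the standing hypotheses and assume p ≤ 0, j' ∈ J, and m' ∈ ℛ^{s,s'}_{j,j',J}. Then p₋ ≥ r and p₊ ≤ s'; moreover, if m ≥ m' then p₊ ≥ min(r,s'), and consequently, if in addition r ≥ s' and m ≥ m', then p₊ = s'. -/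
theorem dE_eq (k i j : ℤ) : dE k i j = max 0 (max (min i j - k) (k - max i j)) := by
  unfold dE
  simp only [abs_eq_max_neg]
  omega

theorem two_dE (k i j : ℤ) : 2 * dE k i j = |k - i| + |k - j| - |i - j| := by
  rw [dE_eq]
  simp only [abs_eq_max_neg]
  omega

/-- standing hypotheses, case p ≤ 0. -/
theorem stmt5 (n i j j' r s s' p p' m m' pp pm aJ bJ : ℤ)
    (hn : 1 ≤ n)
    (hi : 1 ≤ i ∧ i ≤ n) (hj : 1 ≤ j ∧ j ≤ n) (hj2 : 1 ≤ j' ∧ j' ≤ n)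
    (hr : 1 ≤ r) (hs : 1 ≤ s) (hs2 : 1 ≤ s')
    (hp : -(min (min i j - 1) (n - max i j)) ≤ p ∧ p < min r s)
    (hp2 : -(min (min j j' - 1) (n - max j j')) ≤ p' ∧ p' < min s s')
    (hm : m = r + s + |i - j| - 2 * p)
    (hm2 : m' = s + s' + |j - j'| - 2 * p')
    (hnt : |m - m'| ∉ RSet i j' 1 n r s')
    (hpp : pp = s' - p' + p + dE j' i j)
    (hpm : pm = r - p + p' + dE i j j')
    (haJ : aJ = min i j + min p 0) (hbJ : bJ = max i j - min p 0)
    (hple : p ≤ 0) (hj'J : aJ ≤ j' ∧ j' ≤ bJ)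
    (hm'J : m' ∈ RSet j j' aJ bJ s s') :
    r ≤ pm ∧ pp ≤ s' ∧
    (m' ≤ m → min r s' ≤ pp) ∧
    (s' ≤ r → m' ≤ m → pp = s') := by
  obtain ⟨q, hq1, hq2, hq3⟩ := hm'J
  have hqp : q = p' := by omega
  subst hqp
  rw [min_eq_left hple] at haJ hbJ
  subst haJ hbJ
  have hnt' : m' ≤ m → min r s' ≤ pp := by
    intro hle
    by_contra hcon
    apply hnt
    refine ⟨pp, ?_, by omega, ?_⟩
    · have hlow : p + dE j' i j ≤ pp := by omega
      have hp1 := hp.1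
      rw [neg_le, le_min_iff] at hp1
      have key : -(min (min i j' - 1) (n - max i j')) ≤ p + dE j' i j := by
        rw [dE_eq]
        clear hnt hpm hpp hm hm2 hq3 hq1 hq2 hlow hcon hle hp hp2 hr hs hs2
        rw [neg_le, le_min_iff]
        constructor <;> omega
      omega
    · have h2 := two_dE j' i j
      rw [abs_of_nonneg (by omega), abs_sub_comm i j']
      rw [abs_sub_comm j j'] at hm2
      omega
  rw [neg_le, le_min_iff] at hq1
  have hA : r ≤ pm := by
    rw [hpm, dE_eq]
    clear hnt hpp hpm hm hm2 hq3 hnt' hp hp2 hq2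
    omega
  have hB : pp ≤ s' := by
    rw [hpp, dE_eq]
    clear hnt hpp hpm hm hm2 hq3 hnt' hp hp2 hq2
    omega
  refine ⟨hA, hB, hnt', ?_⟩
  intro h1 h2
  have := hnt' h2
  omega
end

section
/- Adopt the standing hypotheses and assume p ≤ 0, j' ∈ J, and m' ∈ ℛ^{s,s'}_{j,j',J}. Then m − m' − ȟ_J ∉ ℛ^{r,s'}_{j,j',J}; consequently |m − m' − ȟ_J| ∈ ℛ^{r,s'}_{j,j',J} if and only if ȟ_J + m' − m ∈ ℛ^{r,s'}_{j,j',J}, and if this holds then p' ≤ min(r,s') − r ≤ 0. -/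
theorem aux_parity (i j j' : ℤ) : ∃ D, |i - j'| + |j - j'| - |i - j| = 2 * D := by
  refine ⟨(|i - j'| + |j - j'| - |i - j|) / 2, ?_⟩
  rcases abs_cases (i - j) with h | h <;> rcases abs_cases (i - j') with h' | h' <;>
    rcases abs_cases (j - j') with h'' | h'' <;> omega

theorem aux_lower (n i j j' p D : ℤ) (h1 : 1 - i ≤ p) (h2 : 1 - j ≤ p)
    (h3 : i - n ≤ p) (h4 : j - n ≤ p)
    (hD : |i - j'| + |j - j'| - |i - j| = 2 * D) :
    1 - i ≤ p + D ∧ 1 - j' ≤ p + D ∧ i - n ≤ p + D ∧ j' - n ≤ p + D := by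
  rcases abs_cases (i - j) with h | h <;> rcases abs_cases (i - j') with h' | h' <;>
    rcases abs_cases (j - j') with h'' | h'' <;> omega

set_option maxHeartbeats 2000000 in
/-- standing hypotheses, case p ≤ 0. -/
theorem stmt6 (n i j j' r s s' p p' m m' pp pm aJ bJ : ℤ)
    (hn : 1 ≤ n)
    (hi : 1 ≤ i ∧ i ≤ n) (hj : 1 ≤ j ∧ j ≤ n) (hj2 : 1 ≤ j' ∧ j' ≤ n)
    (hr : 1 ≤ r) (hs : 1 ≤ s) (hs2 : 1 ≤ s')
    (hp : -(min (min i j - 1) (n - max i j)) ≤ p ∧ p < min r s)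
    (hp2 : -(min (min j j' - 1) (n - max j j')) ≤ p' ∧ p' < min s s')
    (hm : m = r + s + |i - j| - 2 * p)
    (hm2 : m' = s + s' + |j - j'| - 2 * p')
    (hnt : |m - m'| ∉ RSet i j' 1 n r s')
    (hpp : pp = s' - p' + p + dE j' i j)
    (hpm : pm = r - p + p' + dE i j j')
    (haJ : aJ = min i j + min p 0) (hbJ : bJ = max i j - min p 0)
    (hple : p ≤ 0) (hj'J : aJ ≤ j' ∧ j' ≤ bJ)
    (hm'J : m' ∈ RSet j j' aJ bJ s s') :
    m - m' - (bJ - aJ + 2) ∉ RSet j j' aJ bJ r s' ∧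
    (|m - m' - (bJ - aJ + 2)| ∈ RSet j j' aJ bJ r s' ↔
      (bJ - aJ + 2) + m' - m ∈ RSet j j' aJ bJ r s') ∧
    ((bJ - aJ + 2) + m' - m ∈ RSet j j' aJ bJ r s' →
      p' ≤ min r s' - r ∧ min r s' - r ≤ 0) := by
  have hd : bJ - aJ = |i - j| - 2 * p := by
    rw [haJ, hbJ]
    rcases le_total i j with h | h
    · rw [abs_of_nonpos (by omega)]; omega
    · rw [abs_of_nonneg (by omega)]; omega
  have key : m - m' - (bJ - aJ + 2) ∉ RSet j j' aJ bJ r s' := by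
    rintro ⟨q, hq1, hq2, hq⟩
    have hq' : q = s' + |j - j'| - p' + 1 := by omega
    clear hpp hpm hm'J haJ hbJ hj'J hq1
    apply hnt
    have hpos : 0 ≤ m - m' := by
      have := abs_nonneg (j - j')
      have := abs_nonneg (i - j)
      omega
    rw [abs_of_nonneg hpos]
    obtain ⟨D, hD⟩ : ∃ D, |i - j'| + |j - j'| - |i - j| = 2 * D := by
      exact aux_parity i j j'
    refine ⟨s' + p - p' + D, ?_, ?_, ?_⟩
    · have := aux_lower n i j j' p D (by omega) (by omega) (by omega) (by omega) hD
      have hps : p' < s' := lt_of_lt_of_le hp2.2 (min_le_right _ _)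
      clear hp hp2 hq2 hm hm2 hq hq' hd hpos hD hnt
      omega
    · have := abs_sub_le i j j'
      omega
    · omega
  refine ⟨key, ⟨fun h => ?_, fun h => ?_⟩, ?_⟩
  · rcases abs_cases (m - m' - (bJ - aJ + 2)) with h' | h'
    · rw [h'.1] at h
      exact absurd h key
    · rw [h'.1] at h
      convert h using 1
      ring
  · have hpos : 0 ≤ (bJ - aJ + 2) + m' - m := by
      obtain ⟨q, _, hq2, hq⟩ := h
      have := abs_nonneg (j - j')
      omega
    rw [abs_of_nonpos (by omega)]
    convert h using 1
    ring
  · rintro ⟨q, _, hq2, hq⟩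
    omega
end

section
/- Adopt the standing hypotheses and assume p ≤ 0, j' ∈ J, m' ∈ ℛ^{s,s'}_{j,j',J}, and ȟ_J + m' − m ∈ ℛ^{r,s'}_{j,j',J}. Then: (a) if r > 1, one has m − m' + 1 ∉ ℛ^{r−1,s'}_{i,j',J} if and only if r ≤ s'; (b) the condition 'r = 1 or m − m' + 1 ∉ ℛ^{r−1,s'}_{i,j',J}' holds if and only if m + r ≤ m' + s' + |i−j'|. -/
/-- Symmetry of the boundary distance in `[a,b]` under reflection `i ↦ j = a + b - i`. -/
theorem dist_aux (i j k a b p : ℤ) (hple : p ≤ 0) (ha : a = min i j + p) (hb : b = max i j - p)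
    (h1 : a ≤ k) (h2 : k ≤ b) :
    ∃ D, min (min i k - a) (b - max i k) = D ∧ min (min j k - a) (b - max j k) = D ∧
      2 * D + |i - k| + |j - k| = b - a ∧ |i - j| = b - a + 2 * p := by
  refine ⟨_, rfl, ?_, ?_, ?_⟩ <;> grind

set_option maxHeartbeats 2000000 in
/-- standing hypotheses, case p ≤ 0. -/
theorem stmt7 (n i j j' r s s' p p' m m' pp pm aJ bJ : ℤ)
    (hn : 1 ≤ n)
    (hi : 1 ≤ i ∧ i ≤ n) (hj : 1 ≤ j ∧ j ≤ n) (hj2 : 1 ≤ j' ∧ j' ≤ n)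
    (hr : 1 ≤ r) (hs : 1 ≤ s) (hs2 : 1 ≤ s')
    (hp : -(min (min i j - 1) (n - max i j)) ≤ p ∧ p < min r s)
    (hp2 : -(min (min j j' - 1) (n - max j j')) ≤ p' ∧ p' < min s s')
    (hm : m = r + s + |i - j| - 2 * p)
    (hm2 : m' = s + s' + |j - j'| - 2 * p')
    (hnt : |m - m'| ∉ RSet i j' 1 n r s')
    (hpp : pp = s' - p' + p + dE j' i j)
    (hpm : pm = r - p + p' + dE i j j')
    (haJ : aJ = min i j + min p 0) (hbJ : bJ = max i j - min p 0)
    (hple : p ≤ 0) (hj'J : aJ ≤ j' ∧ j' ≤ bJ)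
    (hm'J : m' ∈ RSet j j' aJ bJ s s')
    (hH : (bJ - aJ + 2) + m' - m ∈ RSet j j' aJ bJ r s') :
    (1 < r → (m - m' + 1 ∉ RSet i j' aJ bJ (r - 1) s' ↔ r ≤ s')) ∧
    ((r = 1 ∨ m - m' + 1 ∉ RSet i j' aJ bJ (r - 1) s') ↔
      m + r ≤ m' + s' + |i - j'|) := by
  obtain ⟨q0, h0a, h0b, h0⟩ := hm'J
  obtain ⟨q1, h1a, h1b, h1⟩ := hH
  rw [min_eq_left hple] at haJ hbJ
  obtain ⟨D, hD, hF, hef, hg⟩ := dist_aux i j j' aJ bJ p hple haJ hbJ hj'J.1 hj'J.2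
  have hDI : D ≤ min (min i j' - 1) (n - max i j') := by
    rw [← hD]
    have : 1 ≤ aJ := by omega
    have : bJ ≤ n := by omega
    omega
  rw [hF] at h0a h1a
  have hP : q0 = p' := by linarith
  subst hP
  have hQ : ∃ Q, m - m' = r + s' + |i - j'| - 2 * Q := ⟨s' - q0 - D, by linarith⟩
  obtain ⟨Q, hQ⟩ := hQ
  have e1 : 0 ≤ m - m' → ¬ (-(min (min i j' - 1) (n - max i j')) ≤ Q ∧ Q < min r s') := by
    intro h hc
    exact hnt ⟨Q, hc.1, hc.2, by rw [abs_of_nonneg h]; exact hQ⟩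
  have e2 : m - m' ≤ 0 → ¬ (-(min (min i j' - 1) (n - max i j')) ≤ Q + (m - m') ∧
      Q + (m - m') < min r s') := by
    intro h hc
    exact hnt ⟨Q + (m - m'), hc.1, hc.2, by rw [abs_of_nonpos h]; linarith⟩
  have e3 : m - m' + 1 ∈ RSet i j' aJ bJ (r - 1) s' ↔
      (-(min (min i j' - aJ) (bJ - max i j')) ≤ Q - 1 ∧ Q - 1 < min (r - 1) s') := by
    constructor
    · rintro ⟨q, ha, hb, hc⟩
      have : q = Q - 1 := by linarith
      subst this
      exact ⟨ha, hb⟩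
    · rintro ⟨ha, hb⟩
      exact ⟨Q - 1, ha, hb, by linarith⟩
  rw [e3, hD]
  have he : 0 ≤ |i - j'| := abs_nonneg _
  generalize |i - j'| = e at *
  generalize |j - j'| = f at *
  generalize |i - j| = g at *
  generalize min (min i j' - 1) (n - max i j') = DI at *
  have hQ1 : Q = s' - q0 - D := by linarith
  have hQ2 : Q = r + s' - 1 - D - q1 := by linarith
  clear hD hF hp hp2 hj'J haJ hbJ e3
  have hQ3 : min r s' ≤ Q := by
    by_contra hc
    rcases le_total 0 (m - m') with h | h
    · exact e1 h ⟨by clear e1 e2; omega, not_le.mp hc⟩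
    · clear e1 e2; omega
  have hR : m + r ≤ m' + s' + e ↔ r ≤ Q := by constructor <;> intro <;> linarith
  rw [hR]
  clear hR hef hg h0 h1 hDI hm hm2 hQ he hn hi hj hj2
  constructor
  · intro h; omega
  · omega
end

section
/- Adopt the standing hypotheses and assume p ≥ 0. If m ≥ m' then p₊ ≥ min(r,s'), and if m ≤ m' then p₋ ≥ min(r,s'). -/
set_option maxHeartbeats 2000000 in
/-- standing hypotheses, case p ≥ 0. -/
theorem stmt9 (n i j j' r s s' p p' m m' pp pm aJ bJ : ℤ)
    (hn : 1 ≤ n)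
    (hi : 1 ≤ i ∧ i ≤ n) (hj : 1 ≤ j ∧ j ≤ n) (hj2 : 1 ≤ j' ∧ j' ≤ n)
    (hr : 1 ≤ r) (hs : 1 ≤ s) (hs2 : 1 ≤ s')
    (hp : -(min (min i j - 1) (n - max i j)) ≤ p ∧ p < min r s)
    (hp2 : -(min (min j j' - 1) (n - max j j')) ≤ p' ∧ p' < min s s')
    (hm : m = r + s + |i - j| - 2 * p)
    (hm2 : m' = s + s' + |j - j'| - 2 * p')
    (hnt : |m - m'| ∉ RSet i j' 1 n r s')
    (hpp : pp = s' - p' + p + dE j' i j)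
    (hpm : pm = r - p + p' + dE i j j')
    (haJ : aJ = min i j + min p 0) (hbJ : bJ = max i j - min p 0)
    (hpge : 0 ≤ p) :
    (m' ≤ m → min r s' ≤ pp) ∧ (m ≤ m' → min r s' ≤ pm) := by
  have key : ∀ q : ℤ, -(min (min i j' - 1) (n - max i j')) ≤ q →
      |m - m'| = r + s' + |i - j'| - 2 * q → min r s' ≤ q := by
    intro q h1 h2
    by_contra h
    exact hnt ⟨q, h1, not_le.mp h, h2⟩
  clear hnt
  unfold dE at hpp hpm
  clear haJ hbJ
  have hpr : p < r := lt_of_lt_of_le hp.2 (min_le_left _ _)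
  have hps : p' < s' := lt_of_lt_of_le hp2.2 (min_le_right _ _)
  have hd := hp2.1
  clear hp hp2
  constructor
  · intro h
    apply key
    · rcases abs_cases (j' - i) with h1 | h1 <;> rcases abs_cases (j' - j) with h2 | h2 <;>
        rcases abs_cases (i - j) with h3 | h3 <;> omega
    · rw [abs_of_nonneg (by omega), abs_sub_comm i j']
      rw [abs_sub_comm j j'] at hm2
      rcases abs_cases (j' - i) with h1 | h1 <;> rcases abs_cases (j' - j) with h2 | h2 <;>
        rcases abs_cases (i - j) with h3 | h3 <;> omega
  · intro h
    apply key
    · rcases abs_cases (i - j) with h1 | h1 <;> rcases abs_cases (i - j') with h2 | h2 <;>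
        rcases abs_cases (j - j') with h3 | h3 <;> omega
    · rw [abs_of_nonpos (by omega)]
      rcases abs_cases (i - j) with h1 | h1 <;> rcases abs_cases (i - j') with h2 | h2 <;>
        rcases abs_cases (j - j') with h3 | h3 <;> omega
end

section
/- Adopt the standing hypotheses and assume p ≥ 0, j' ∈ [i,j], and m' ∈ ℛ^{s,s'}_{j,j',[i,j]}. Then: (a) m − m' − ȟ_{[i,j]} ∉ ℛ^{r,s'}_{j,j',[i,j]}; (b) ȟ_{[i,j]} + m' − m ∈ ℛ^{r,s'}_{j,j',[i,j]} if and only if 0 ≤ r − p + p' − 1 < min(r,s'); (c) if the condition in (b) holds, then p ≥ p', and if moreover r ≥ s' then r ≤ s' + p − p'. -/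
/-- standing hypotheses, case p ≥ 0. -/
theorem stmt10 (n i j j' r s s' p p' m m' pp pm aJ bJ : ℤ)
    (hn : 1 ≤ n)
    (hi : 1 ≤ i ∧ i ≤ n) (hj : 1 ≤ j ∧ j ≤ n) (hj2 : 1 ≤ j' ∧ j' ≤ n)
    (hr : 1 ≤ r) (hs : 1 ≤ s) (hs2 : 1 ≤ s')
    (hp : -(min (min i j - 1) (n - max i j)) ≤ p ∧ p < min r s)
    (hp2 : -(min (min j j' - 1) (n - max j j')) ≤ p' ∧ p' < min s s')
    (hm : m = r + s + |i - j| - 2 * p)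
    (hm2 : m' = s + s' + |j - j'| - 2 * p')
    (hnt : |m - m'| ∉ RSet i j' 1 n r s')
    (hpp : pp = s' - p' + p + dE j' i j)
    (hpm : pm = r - p + p' + dE i j j')
    (haJ : aJ = min i j + min p 0) (hbJ : bJ = max i j - min p 0)
    (hpge : 0 ≤ p) (hj'ij : min i j ≤ j' ∧ j' ≤ max i j)
    (hm'J : m' ∈ RSet j j' (min i j) (max i j) s s') :
    m - m' - (|i - j| + 2) ∉ RSet j j' (min i j) (max i j) r s' ∧
    ((|i - j| + 2) + m' - m ∈ RSet j j' (min i j) (max i j) r s' ↔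
      (0 ≤ r - p + p' - 1 ∧ r - p + p' - 1 < min r s')) ∧
    ((|i - j| + 2) + m' - m ∈ RSet j j' (min i j) (max i j) r s' →
      p' ≤ p ∧ (s' ≤ r → r ≤ s' + p - p')) := by
  clear hpp hpm haJ hbJ
  have hsplit : |i - j| = |i - j'| + |j - j'| := by
    rcases abs_cases (i - j) with h | h <;> rcases abs_cases (i - j') with h' | h' <;>
      rcases abs_cases (j - j') with h'' | h'' <;> omega
  have hnn := abs_nonneg (j - j')
  have hnn' := abs_nonneg (i - j')
  have hd : min (min j j' - min i j) (max i j - max j j') = 0 := by omega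
  simp only [RSet, Set.mem_setOf_eq, hd] at hm'J ⊢
  generalize hA : |i - j'| = A at *
  generalize hB : |j - j'| = B at *
  generalize hC : |i - j| = C at *
  obtain ⟨q', hq1, hq2, hq3⟩ := hm'J
  refine ⟨?_, ⟨?_, ?_⟩, ?_⟩
  · rintro ⟨q, h1, h2, h3⟩
    apply hnt
    refine ⟨s' + p - p', by omega, by omega, ?_⟩
    rw [abs_of_nonneg (by omega)]
    omega
  · rintro ⟨q, h1, h2, h3⟩
    omega
  · rintro ⟨h1, h2⟩
    exact ⟨r - p + p' - 1, by omega, by omega, by omega⟩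
  · rintro ⟨q, h1, h2, h3⟩
    omega
end

section
/- Let C be an abelian rigid monoidal category in which the tensor product of morphisms is additive in each variable (monoidal preadditive), for instance the category of finite-dimensional modules over a Hopf algebra over a field. Let V₁, V₂, V₃, L₁, L₂ be objects of C with V₂ simple, and let φ₁ : L₁ → V₁ ⊗ V₂ and φ₂ : V₂ ⊗ V₃ → L₂ be nonzero morphisms. Then the composite L₁ ⊗ V₃ → (V₁ ⊗ V₂) ⊗ V₃ ≅ V₁ ⊗ (V₂ ⊗ V₃) → V₁ ⊗ L₂, given by (id_{V₁} ⊗ φ₂) ∘ α_{V₁,V₂,V₃} ∘ (φ₁ ⊗ id_{V₃}) where α is the associator, is nonzero. -/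
open CategoryTheory MonoidalCategory

/-- in an abelian rigid monoidal preadditive category, with `V₂`
simple and nonzero `φ₁ : L₁ ⟶ V₁ ⊗ V₂`, `φ₂ : V₂ ⊗ V₃ ⟶ L₂`, the composite
`L₁ ⊗ V₃ ⟶ (V₁ ⊗ V₂) ⊗ V₃ ≅ V₁ ⊗ (V₂ ⊗ V₃) ⟶ V₁ ⊗ L₂` is nonzero. -/
theorem stmt17 {C : Type*} [Category C] [Abelian C] [MonoidalCategory C]
    [MonoidalPreadditive C] [RigidCategory C]
    (V₁ V₂ V₃ L₁ L₂ : C) [Simple V₂]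
    (φ₁ : L₁ ⟶ V₁ ⊗ V₂) (φ₂ : V₂ ⊗ V₃ ⟶ L₂)
    (h₁ : φ₁ ≠ 0) (h₂ : φ₂ ≠ 0) :
    (φ₁ ▷ V₃) ≫ (α_ V₁ V₂ V₃).hom ≫ (V₁ ◁ φ₂) ≠ 0 := by
  intro h
  let f : (HasRightDual.rightDual V₁) ⊗ L₁ ⟶ V₂ := (tensorLeftHomEquiv L₁ V₁ (HasRightDual.rightDual V₁) V₂).symm φ₁
  have hf : f = (HasRightDual.rightDual V₁) ◁ φ₁ ≫ (α_ _ _ _).inv ≫ ε_ V₁ (HasRightDual.rightDual V₁) ▷ V₂ ≫ (λ_ _).hom := rfl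
  have hf0 : f ≠ 0 := by
    intro h0
    apply h₁
    have h3 : φ₁ = tensorLeftHomEquiv L₁ V₁ (HasRightDual.rightDual V₁) V₂ f :=
      ((tensorLeftHomEquiv L₁ V₁ (HasRightDual.rightDual V₁) V₂).apply_symm_apply φ₁).symm
    rw [h3, h0]
    simp [tensorLeftHomEquiv]
  have hepi : Epi f := epi_of_nonzero_to_simple hf0
  have hadj := tensorRightAdjunction V₃ (HasRightDual.rightDual V₃)
  have : (tensorRight V₃).IsLeftAdjoint := hadj.isLeftAdjoint
  have hepi2 : Epi (f ▷ V₃) := inferInstanceAs (Epi ((tensorRight V₃).map f))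
  apply h₂
  rw [← cancel_epi (f ▷ V₃), Limits.comp_zero]
  have key : f ▷ V₃ ≫ φ₂ = (α_ _ _ _).hom ≫
      (HasRightDual.rightDual V₁) ◁ (φ₁ ▷ V₃ ≫ (α_ V₁ V₂ V₃).hom ≫ V₁ ◁ φ₂) ≫
      (α_ _ _ _).inv ≫ ε_ V₁ (HasRightDual.rightDual V₁) ▷ L₂ ≫ (λ_ _).hom := by
    have e : ((HasRightDual.rightDual V₁) ◁ V₁ ◁ φ₂) ≫ (α_ _ _ _).inv ≫ ε_ V₁ (HasRightDual.rightDual V₁) ▷ L₂ ≫ (λ_ _).hom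
        = (α_ _ _ _).inv ≫ ε_ V₁ (HasRightDual.rightDual V₁) ▷ (V₂ ⊗ V₃) ≫ (λ_ _).hom ≫ φ₂ := by
      rw [associator_inv_naturality_right_assoc, whisker_exchange_assoc,
        leftUnitor_naturality]
    rw [hf]
    simp only [MonoidalCategory.whiskerLeft_comp, Category.assoc, e]
    monoidal
  rw [key, h]
  simp
end

section
/- Let C be an abelian rigid monoidal category in which the tensor product of morphisms is additive in each variable (monoidal preadditive), for instance the category of finite-dimensional modules over a Hopf algebra over a field. Let V₁, V₂, V₃, L₁, L₂ be objects of C with V₂ simple, and let φ₁ : V₁ ⊗ V₂ → L₁ and φ₂ : L₂ → V₂ ⊗ V₃ be nonzero morphisms. Then the composite V₁ ⊗ L₂ → V₁ ⊗ (V₂ ⊗ V₃) ≅ (V₁ ⊗ V₂) ⊗ V₃ → L₁ ⊗ V₃, given by (φ₁ ⊗ id_{V₃}) ∘ α⁻¹_{V₁,V₂,V₃} ∘ (id_{V₁} ⊗ φ₂) where α is the associator, is nonzero. -/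
open CategoryTheory MonoidalCategory

/-- The mate of `α⁻¹ ≫ f ▷ W` is the mate of `f`, whiskered by `W`. -/
theorem mate_whisker_aux {C : Type*} [Category C] [MonoidalCategory C]
    {X Y Y' Z : C} [ExactPairing Y Y'] (W : C) (f : Y' ⊗ X ⟶ Z) :
    tensorLeftHomEquiv (X ⊗ W) Y Y' (Z ⊗ W) ((α_ Y' X W).inv ≫ f ▷ W) =
      (tensorLeftHomEquiv X Y Y' Z f) ▷ W ≫ (α_ Y Z W).hom := by
  dsimp [tensorLeftHomEquiv]
  monoidal

/-- in an abelian rigid monoidal preadditive category, with `V₂`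
simple and nonzero `φ₁ : V₁ ⊗ V₂ ⟶ L₁`, `φ₂ : L₂ ⟶ V₂ ⊗ V₃`, the composite
`V₁ ⊗ L₂ ⟶ V₁ ⊗ (V₂ ⊗ V₃) ≅ (V₁ ⊗ V₂) ⊗ V₃ ⟶ L₁ ⊗ V₃` is nonzero. -/
theorem stmt18 {C : Type*} [Category C] [Abelian C] [MonoidalCategory C]
    [MonoidalPreadditive C] [RigidCategory C]
    (V₁ V₂ V₃ L₁ L₂ : C) [Simple V₂]
    (φ₁ : V₁ ⊗ V₂ ⟶ L₁) (φ₂ : L₂ ⟶ V₂ ⊗ V₃)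
    (h₁ : φ₁ ≠ 0) (h₂ : φ₂ ≠ 0) :
    (V₁ ◁ φ₂) ≫ (α_ V₁ V₂ V₃).inv ≫ (φ₁ ▷ V₃) ≠ 0 := by
  intro h
  have zero_mate : ∀ X Z : C, (tensorLeftHomEquiv X (ᘁV₁) V₁ Z) 0 = 0 := by
    intro X Z
    simp [tensorLeftHomEquiv]
  have hψ : tensorLeftHomEquiv V₂ (ᘁV₁) V₁ L₁ φ₁ ≠ 0 := by
    intro h0
    apply h₁
    apply (tensorLeftHomEquiv V₂ (ᘁV₁) V₁ L₁).injective
    rw [h0, zero_mate]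
  have hm : Mono (tensorLeftHomEquiv V₂ (ᘁV₁) V₁ L₁ φ₁) := mono_of_nonzero_from_simple hψ
  have hadj : (tensorRight V₃).IsRightAdjoint :=
    (tensorRightAdjunction (ᘁV₃) V₃).isRightAdjoint
  have hm' : Mono ((tensorLeftHomEquiv V₂ (ᘁV₁) V₁ L₁ φ₁) ▷ V₃) :=
    inferInstanceAs (Mono ((tensorRight V₃).map (tensorLeftHomEquiv V₂ (ᘁV₁) V₁ L₁ φ₁)))
  have key := tensorLeftHomEquiv_symm_naturality (Y := ᘁV₁) (Y' := V₁) φ₂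
    (tensorLeftHomEquiv (V₂ ⊗ V₃) (ᘁV₁) V₁ (L₁ ⊗ V₃) ((α_ V₁ V₂ V₃).inv ≫ φ₁ ▷ V₃))
  rw [Equiv.symm_apply_apply, h, Equiv.symm_apply_eq, zero_mate, mate_whisker_aux,
    ← Category.assoc] at key
  apply h₂
  rw [← cancel_mono ((tensorLeftHomEquiv V₂ (ᘁV₁) V₁ L₁ φ₁) ▷ V₃),
    ← cancel_mono (α_ (ᘁV₁) L₁ V₃).hom, key]
  simp
end
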